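/- The measure m̂ on Ω defined by dm̂(ξ₋,ξ₊) = q² dμ(ξ₋) dμ(ξ₊)/|ξ₊ − ξ₋|²_∞ is a probability measure; that is, q² ∫_{ξ₋ ∈ J} ∫_{ξ₊ ∈ X⁻¹O} |ξ₊ − ξ₋|_∞^{−2} dμ(ξ₊) dμ(ξ₋) = 1 (the countable set K being μ-null, integrating over J × X⁻¹O or over Ω gives the same value). -/

import Mathlib

open MeasureTheory
open scoped ENNReal Classical

noncomputable section

namespace ArtinCoding

variable (k : Type*) [Field k] [Fintype k]

/-- The field `K̂ = k((X⁻¹))` of formal Laurent series in `X⁻¹` over `k`, realized as the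
field of formal Laurent series `k((t))` in the variable `t = X⁻¹`. -/
abbrev Khat := LaurentSeries k

variable {k}

/-- The absolute value `|f|_∞ = q^{-v_∞(f)}`, where `v_∞` is the order of vanishing in the
variable `t = X⁻¹` (so a nonzero polynomial in `X` has absolute value `≥ 1`). -/
def absInf (f : Khat k) : ℝ :=
  if f = 0 then 0 else (Fintype.card k : ℝ) ^ (-f.order)

lemma absInf_nonneg (f : Khat k) : 0 ≤ absInf f := by
  unfold absInf
  split
  · exact le_refl 0
  · positivity

lemma absInf_eq_zero {f : Khat k} : absInf f = 0 ↔ f = 0 := by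
  constructor
  · intro h
    by_contra hf
    have hq : (0:ℝ) < (Fintype.card k : ℝ) := by
      have := Fintype.card_pos (α := k); positivity
    rw [absInf, if_neg hf] at h
    exact absurd h (ne_of_gt (zpow_pos hq _))
  · intro h; simp [absInf, h]

lemma absInf_neg (f : Khat k) : absInf (-f) = absInf f := by
  unfold absInf
  rw [neg_eq_zero, HahnSeries.order_neg]

lemma absInf_add_le (f g : Khat k) : absInf (f + g) ≤ max (absInf f) (absInf g) := by
  rcases eq_or_ne (f + g) 0 with h | h
  · rw [show absInf (f+g) = 0 by rw [absInf_eq_zero]; exact h]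
    exact le_max_of_le_left (absInf_nonneg f)
  rcases eq_or_ne f 0 with hf | hf
  · simp [hf]
  rcases eq_or_ne g 0 with hg | hg
  · simp [hg]
  have hmin := HahnSeries.min_order_le_order_add h
  have hq : (1:ℝ) ≤ (Fintype.card k : ℝ) := by
    exact_mod_cast Nat.one_le_iff_ne_zero.mpr Fintype.card_ne_zero
  rw [absInf, if_neg h]
  rcases le_total f.order g.order with hod | hod
  · rw [min_eq_left hod] at hmin
    refine le_max_of_le_left ?_
    rw [absInf, if_neg hf]
    exact zpow_le_zpow_right₀ hq (neg_le_neg hmin)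
  · rw [min_eq_right hod] at hmin
    refine le_max_of_le_right ?_
    rw [absInf, if_neg hg]
    exact zpow_le_zpow_right₀ hq (neg_le_neg hmin)

/-- The metric `d_∞(f,g) = |f-g|_∞` on `K̂`. -/
noncomputable instance : MetricSpace (Khat k) where
  dist f g := absInf (f - g)
  dist_self f := by simp [absInf]
  dist_comm f g := by
    have : g - f = -(f - g) := by ring
    show absInf (f - g) = absInf (g - f)
    rw [this, absInf_neg]
  dist_triangle f g h := by
    show absInf (f - h) ≤ absInf (f - g) + absInf (g - h)
    have key : absInf (f - h) ≤ max (absInf (f - g)) (absInf (g - h)) := by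
      have : f - h = (f - g) + (g - h) := by ring
      rw [this]; exact absInf_add_le _ _
    exact key.trans (max_le_add_of_nonneg (absInf_nonneg _) (absInf_nonneg _))
  eq_of_dist_eq_zero := by
    intro f g h
    have : f - g = 0 := absInf_eq_zero.mp h
    exact sub_eq_zero.mp this

/- Make sure the topology coming from the metric `d_∞` is the one used everywhere
(the valued-field uniformity on Laurent series induces the same topology). -/
instance (priority := 10000) : UniformSpace (Khat k) := PseudoMetricSpace.toUniformSpace
instance (priority := 10000) : TopologicalSpace (Khat k) := UniformSpace.toTopologicalSpace

instance : MeasurableSpace (Khat k) := borel _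
instance : BorelSpace (Khat k) := ⟨rfl⟩

variable (k)

/-- The element `X⁻¹` of `K̂` (the uniformizer `t`). -/
def Xinv : Khat k := HahnSeries.single (1 : ℤ) (1 : k)

/-- The element `X` of `K̂`. -/
def Xel : Khat k := HahnSeries.single (-1 : ℤ) (1 : k)

/-- The valuation ring `O = k[[X⁻¹]] = {f : |f|_∞ ≤ 1}`. -/
def Oball : Set (Khat k) := {f | absInf f ≤ 1}

/-- The set `X⁻¹O`, i.e. the maximal ideal of `O`. -/
def XinvO : Set (Khat k) := (fun f => Xinv k * f) '' Oball k

/-- The ring `A = k[X]` of polynomials in `X`, viewed as a subset of `K̂`. -/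
def Aset : Set (Khat k) := Set.range fun p : Polynomial k => Polynomial.aeval (Xel k) p

/-- The constants `k ⊆ K̂`. -/
def kconsts : Set (Khat k) := Set.range (algebraMap k (Khat k))

/-- The set `A∖k` of nonconstant polynomials in `X`, viewed inside `K̂`. -/
def AmK : Set (Khat k) := Aset k \ kconsts k

/-- The field `K = k(X)` of rational functions, viewed as a subset of `K̂`
(note that `k(X) = k(X⁻¹)` as a subfield of `K̂`). -/
def Kset : Set (Khat k) := Set.range fun r : RatFunc k => (r : LaurentSeries k)

/-- The set `ᶜK = K̂ ∖ K` of irrational elements. -/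
def cK : Set (Khat k) := (Kset k)ᶜ

variable {k}

/-- The integer part `[f] ∈ A = k[X]` of `f ∈ K̂`: the sum of the terms of `f` with
nonpositive exponents in `t = X⁻¹`. -/
def intPart (f : Khat k) : Khat k :=
  ∑ i ∈ Finset.Icc (min f.order 0) 0, HahnSeries.single i (f.coeff i)

/-- The fractional part `{f} = f - [f] ∈ X⁻¹O` of `f ∈ K̂`. -/
def fracPart (f : Khat k) : Khat k := f - intPart f

/-- The Artin map `Ψ(f) = 1/f - [1/f]`. -/
def ArtinPsi (f : Khat k) : Khat k := fracPart f⁻¹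

/-- The Artin continued fraction digit `a_{n+1}(f) = [1/Ψⁿ(f)]` (for `n : ℕ`, so that
`digit 0 f = a₁(f) = [1/f]`). -/
def digit (n : ℕ) (f : Khat k) : Khat k := intPart ((ArtinPsi (k := k))^[n] f)⁻¹

variable (k)

/-- The set `J = ⋃_{a ∈ A∖k} (a + X⁻¹O)`. -/
def Jset : Set (Khat k) := ⋃ a ∈ AmK k, (fun x => a + x) '' XinvO k

/-- The domain `Ω = (J ∩ ᶜK) × (X⁻¹O ∩ ᶜK)` of the natural extension of the Artin map. -/
def OmegaSet : Set (Khat k × Khat k) := (Jset k ∩ cK k) ×ˢ (XinvO k ∩ cK k)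

variable {k}

/-- The map `Φ(ξ₋, ξ₊) = (1/ξ₋ - [1/ξ₊], Ψ(ξ₊))` (as a globally defined map on `K̂ × K̂`). -/
def PhiRaw (p : Khat k × Khat k) : Khat k × Khat k :=
  (p.1⁻¹ - intPart p.2⁻¹, ArtinPsi p.2)

/-- The coding map `Θ'` sending `(ξ₋, ξ₊)` to the bilateral sequence `(c_n)_{n ∈ ℤ}` with
`c_n = a_n(ξ₊)` for `n ≥ 1` and `c_{-n} = a_{n+1}(-1/ξ₋)` for `n ≥ 0`. -/
def ThetaRaw (p : Khat k × Khat k) : ℤ → Khat k := fun n =>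
  if 1 ≤ n then digit (n - 1).toNat p.2 else digit (-n).toNat (-p.1⁻¹)

variable (k)

/-- The density `q²/|ξ₊ - ξ₋|²_∞`. -/
def dens (p : Khat k × Khat k) : ℝ≥0∞ :=
  ENNReal.ofReal ((Fintype.card k : ℝ) ^ 2 * ((absInf (p.2 - p.1)) ^ 2)⁻¹)

/-- The measure `m̂` on `Ω` given by `dm̂(ξ₋,ξ₊) = q² dμ(ξ₋) dμ(ξ₊)/|ξ₊ - ξ₋|²_∞`. -/
def mhat (μ : Measure (Khat k)) : Measure (Khat k × Khat k) :=
  (((μ.prod μ).withDensity (dens k))).restrict (OmegaSet k)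

/-- The weight `ν(a) = |a|_∞⁻² = q^{-2 deg a}` for `a ∈ A∖k` (and `0` otherwise),
with values in `ℝ≥0∞`. -/
def nuE (a : Khat k) : ℝ≥0∞ :=
  if a ∈ AmK k then ENNReal.ofReal (((absInf a) ^ 2)⁻¹) else 0

section Helpers

variable {k}

/-- The fractional ideal `X⁻ⁿO`: Laurent series with no terms of exponent below `n`. -/
def ordBall (k : Type*) [Field k] (n : ℤ) : Set (Khat k) := {f | ∀ i < n, f.coeff i = 0}

lemma one_lt_card_real : (1 : ℝ) < Fintype.card k := by
  exact_mod_cast Fintype.one_lt_card (α := k)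

lemma absInf_eq_of_mem_ordBall {n : ℤ} {f : Khat k} (h : f ∈ ordBall k n)
    (h' : f ∉ ordBall k (n + 1)) : absInf f = (Fintype.card k : ℝ) ^ (-n) := by
  have hc : f.coeff n ≠ 0 := by
    intro h0
    refine h' fun i hi => ?_
    rcases (Int.lt_add_one_iff.mp hi).lt_or_eq with hi | rfl
    · exact h i hi
    · exact h0
  have hf : f ≠ 0 := by rintro rfl; simp at hc
  have ho : f.order = n := by
    refine le_antisymm (HahnSeries.order_le_of_coeff_ne_zero hc) ?_
    by_contra! hlt
    exact HahnSeries.coeff_order_eq_zero.not.mpr hf (h _ hlt)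
  rw [absInf, if_neg hf, ho]

omit [Fintype k] in
lemma mem_ordBall_order (f : Khat k) : f ∈ ordBall k f.order :=
  fun _ hi => HahnSeries.coeff_eq_zero_of_lt_order hi

omit [Fintype k] in
lemma not_mem_ordBall_order_add_one {f : Khat k} (hf : f ≠ 0) :
    f ∉ ordBall k (f.order + 1) :=
  fun h => HahnSeries.coeff_order_eq_zero.not.mpr hf (h _ (lt_add_one _))

omit [Fintype k] in
lemma ordBall_anti {m n : ℤ} (h : m ≤ n) : ordBall k n ⊆ ordBall k m :=
  fun _ hf i hi => hf i (hi.trans_le h)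

lemma ordBall_eq (n : ℤ) :
    ordBall k n = {f : Khat k | absInf f ≤ (Fintype.card k : ℝ) ^ (-n)} := by
  ext f
  rcases eq_or_ne f 0 with rfl | hf
  · have : (0 : ℝ) ≤ (Fintype.card k : ℝ) ^ n := by positivity
    simpa [ordBall, absInf] using this
  · rw [Set.mem_ofPred_eq, absInf, if_neg hf, zpow_le_zpow_iff_right₀ one_lt_card_real,
      neg_le_neg_iff]
    refine ⟨fun h => ?_, fun h => ordBall_anti h (mem_ordBall_order f)⟩
    by_contra! hlt
    exact not_mem_ordBall_order_add_one hf (ordBall_anti hlt h)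

lemma Oball_eq_ordBall : Oball k = ordBall k 0 := by
  simp [ordBall_eq, Oball]

lemma XinvO_eq_ordBall : XinvO k = ordBall k 1 := by
  rw [XinvO, Oball_eq_ordBall]
  ext f
  constructor
  · rintro ⟨g, hg, rfl⟩ i hi
    have := HahnSeries.coeff_single_mul_add (r := (1 : k)) (x := g) (a := i - 1) (b := 1)
    rw [sub_add_cancel] at this
    simp only [Xinv]
    rw [this, hg _ (by lia), mul_zero]
  · intro hf
    refine ⟨Xel k * f, fun i hi => ?_, ?_⟩
    · have := HahnSeries.coeff_single_mul_add (r := (1 : k)) (x := f) (a := i + 1) (b := -1)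
      rw [add_neg_cancel_right] at this
      rw [Xel, this, hf _ (by lia), mul_zero]
    · simp only [Xinv, Xel]
      rw [← mul_assoc, HahnSeries.single_mul_single]
      simp

omit [Fintype k] in
lemma algebraMap_Khat_apply (c : k) :
    algebraMap k (Khat k) c = HahnSeries.single 0 c := by
  rw [HahnSeries.algebraMap_apply', PowerSeries.algebraMap_apply, HahnSeries.ofPowerSeries_C,
    HahnSeries.C_apply, Algebra.algebraMap_self, RingHom.id_apply]

omit [Fintype k] in
lemma coeff_aeval_Xel (p : Polynomial k) (n : ℤ) :
    (Polynomial.aeval (Xel k) p).coeff n = if n ≤ 0 then p.coeff (-n).toNat else 0 := by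
  induction p using Polynomial.induction_on' with
  | add p q hp hq =>
    rw [map_add, HahnSeries.coeff_add, hp, hq]
    split_ifs <;> simp
  | monomial m c =>
    rw [Polynomial.aeval_monomial, Xel, HahnSeries.single_pow, one_pow,
      algebraMap_Khat_apply, HahnSeries.single_mul_single,
      HahnSeries.coeff_single, Polynomial.coeff_monomial]
    simp only [mul_one, zero_add, smul_neg,
      nsmul_eq_mul]
    split_ifs <;> first | rfl | (exfalso; lia)

lemma Jset_eq_compl_ordBall : Jset k = (ordBall k 0)ᶜ := by
  ext f
  simp only [Jset, XinvO_eq_ordBall, Set.mem_iUnion, Set.mem_image, Set.mem_compl_iff]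
  constructor
  · rintro ⟨a, ⟨⟨p, rfl⟩, hc⟩, x, hx, rfl⟩ h
    refine hc ⟨p.coeff 0, ?_⟩
    ext n
    rw [algebraMap_Khat_apply, HahnSeries.coeff_single]
    rcases lt_trichotomy n 0 with hn | rfl | hn
    · have := h n hn
      rw [HahnSeries.coeff_add, hx n (by lia), add_zero] at this
      rw [if_neg hn.ne]
      exact this.symm
    · simp [coeff_aeval_Xel]
    · rw [if_neg hn.ne']
      simp [coeff_aeval_Xel, hn.not_ge]
  · intro hf
    let p : Polynomial k :=
      ∑ i ∈ Finset.range ((-f.order).toNat + 1), Polynomial.monomial i (f.coeff (-i))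
    have hp (n : ℤ) : (Polynomial.aeval (Xel k) p).coeff n = if n ≤ 0 then f.coeff n else 0 := by
      rw [coeff_aeval_Xel]
      split_ifs with hn
      · simp only [p, Polynomial.finsetSum_coeff, Polynomial.coeff_monomial,
          Finset.sum_ite_eq', Finset.mem_range]
        have hn' : -(((-n).toNat : ℕ) : ℤ) = n := by lia
        split_ifs with h
        · rw [hn']
        · exact (HahnSeries.coeff_eq_zero_of_lt_order (by lia)).symm
      · rfl
    refine ⟨Polynomial.aeval (Xel k) p, ⟨⟨p, rfl⟩, ?_⟩, f - Polynomial.aeval (Xel k) p,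
      fun i hi => ?_, by abel⟩
    · rintro ⟨c, hc⟩
      refine hf fun i hi => ?_
      have := hp i
      rw [← hc, algebraMap_Khat_apply, HahnSeries.coeff_single,
        if_neg hi.ne, if_pos hi.le] at this
      exact this.symm
    · rw [HahnSeries.coeff_sub, hp, if_pos (by lia), sub_self]

lemma absInf_sub_of_mem {x y : Khat k} (hx : x ∈ Jset k) (hy : y ∈ XinvO k) :
    absInf (y - x) = absInf x := by
  rw [Jset_eq_compl_ordBall] at hx
  rw [XinvO_eq_ordBall] at hy
  have hx0 : x ≠ 0 := by rintro rfl; exact hx fun _ _ => rfl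
  have ho : x.order < 0 := by
    by_contra! h
    exact hx (ordBall_anti h (mem_ordBall_order x))
  rw [absInf_eq_of_mem_ordBall (mem_ordBall_order x) (not_mem_ordBall_order_add_one hx0)]
  apply absInf_eq_of_mem_ordBall
  · intro i hi
    rw [HahnSeries.coeff_sub, hy i (by lia), mem_ordBall_order x i hi, sub_zero]
  · intro h
    refine not_mem_ordBall_order_add_one hx0 fun i hi => ?_
    have := h i hi
    rwa [HahnSeries.coeff_sub, hy i (by lia), zero_sub, neg_eq_zero] at this

lemma measurable_absInf : Measurable (absInf : Khat k → ℝ) := by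
  have h : (absInf : Khat k → ℝ) = fun f => dist f 0 := by
    funext f
    change absInf f = absInf (f - 0)
    rw [sub_zero]
  rw [h]
  exact (continuous_id.dist continuous_const).measurable

lemma measurableSet_ordBall (n : ℤ) : MeasurableSet (ordBall k n) := by
  rw [ordBall_eq]
  exact measurable_absInf measurableSet_Iic

lemma measurable_const_add_Khat (x : Khat k) : Measurable fun y : Khat k => x + y := by
  refine (Isometry.continuous (Isometry.of_dist_eq fun f g => ?_)).measurable
  change absInf (x + f - (x + g)) = absInf (f - g)
  rw [add_sub_add_left_eq_sub]

lemma measurableSet_Jset : MeasurableSet (Jset k) := by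
  rw [Jset_eq_compl_ordBall]
  exact (measurableSet_ordBall 0).compl

lemma measurableSet_XinvO : MeasurableSet (XinvO k) := by
  rw [XinvO_eq_ordBall]
  exact measurableSet_ordBall 1

lemma countable_Kset : (Kset k).Countable := by
  have : Countable (Polynomial k) := by
    have : Function.Injective (fun p : Polynomial k => p.toFinsupp.coeff) := by
      intro p q h
      ext n
      exact DFunLike.congr_fun h n
    exact this.countable
  have : Countable (RatFunc k) := by
    have : Function.Injective (fun r : RatFunc k => (r.num, r.denom)) := by
      intro r s h
      obtain ⟨h1, h2⟩ := Prod.mk.inj h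
      rw [← RatFunc.num_div_denom r, ← RatFunc.num_div_denom s, h1, h2]
    exact this.countable
  exact Set.countable_range _

omit [Fintype k] in
lemma iUnion_ordBall_neg : ⋃ d : ℕ, ordBall k (-d) = Set.univ := by
  refine Set.eq_univ_of_forall fun f => Set.mem_iUnion.mpr ⟨(-f.order).toNat, ?_⟩
  exact ordBall_anti (by lia) (mem_ordBall_order f)

section Invariant

variable {μ : Measure (Khat k)} (hinv : ∀ x : Khat k, μ.map (fun y => x + y) = μ)
  (hO : μ (Oball k) = 1)
include hinv

lemma measure_preimage_add_Khat (x : Khat k) {s : Set (Khat k)} (hs : MeasurableSet s) :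
    μ ((fun y => x + y) ⁻¹' s) = μ s := by
  rw [← Measure.map_apply (measurable_const_add_Khat x) hs, hinv]

lemma measure_ordBall_succ (n : ℤ) :
    μ (ordBall k n) = Fintype.card k * μ (ordBall k (n + 1)) := by
  have hU : ordBall k n = ⋃ c : k,
      (fun y => HahnSeries.single n (-c) + y) ⁻¹' ordBall k (n + 1) := by
    ext f
    simp only [Set.mem_iUnion, Set.mem_preimage]
    constructor
    · intro hf
      refine ⟨f.coeff n, fun i hi => ?_⟩
      rw [HahnSeries.coeff_add, HahnSeries.coeff_single]
      split_ifs with h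
      · rw [h, neg_add_cancel]
      · rw [hf i (by lia), add_zero]
    · rintro ⟨c, hc⟩ i hi
      have := hc i (by lia)
      rwa [HahnSeries.coeff_add, HahnSeries.coeff_single, if_neg hi.ne, zero_add] at this
  have hd : Pairwise (Function.onFun Disjoint fun c : k =>
      (fun y : Khat k => HahnSeries.single n (-c) + y) ⁻¹' ordBall k (n + 1)) := by
    intro c c' hcc
    refine Set.disjoint_left.mpr fun f hf hf' => hcc ?_
    have h1 := hf n (by lia)
    have h2 := hf' n (by lia)
    rw [HahnSeries.coeff_add, HahnSeries.coeff_single_same] at h1 h2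
    exact (neg_add_eq_zero.mp h1).trans (neg_add_eq_zero.mp h2).symm
  rw [hU, measure_iUnion hd fun c => measurable_const_add_Khat _ (measurableSet_ordBall _)]
  simp_rw [measure_preimage_add_Khat hinv _ (measurableSet_ordBall (n + 1))]
  rw [tsum_fintype, Finset.sum_const, Finset.card_univ, nsmul_eq_mul]

include hO

lemma measure_ordBall_neg (d : ℕ) : μ (ordBall k (-d)) = (Fintype.card k : ℝ≥0∞) ^ d := by
  induction d with
  | zero => simpa [← Oball_eq_ordBall] using hO
  | succ d ih =>
    rw [measure_ordBall_succ hinv, pow_succ', ← ih]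
    congr 3
    push_cast
    ring

lemma measure_XinvO : μ (XinvO k) = (Fintype.card k : ℝ≥0∞)⁻¹ := by
  have h := measure_ordBall_succ hinv 0
  rw [← Oball_eq_ordBall, hO, zero_add, ← XinvO_eq_ordBall] at h
  exact ENNReal.eq_inv_of_mul_eq_one_left (by rw [mul_comm]; exact h.symm)

lemma sigmaFinite_of_invariant : SigmaFinite μ :=
  ⟨⟨⟨fun d : ℕ => ordBall k (-d), fun _ => trivial, fun d => by
    rw [measure_ordBall_neg hinv hO]
    exact ENNReal.pow_lt_top (ENNReal.natCast_lt_top _), iUnion_ordBall_neg⟩⟩⟩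

lemma measure_singleton_Khat (x : Khat k) : μ {x} = 0 := by
  have hx (y : Khat k) : μ {y} = μ {0} := by
    rw [← measure_preimage_add_Khat hinv y (measurableSet_singleton y)]
    congr 1
    ext z
    simp
  by_contra hne
  have hinf : (Oball k).Infinite := by
    refine Set.infinite_of_injective_forall_mem
      (f := fun n : ℕ => (HahnSeries.single (n : ℤ) (1 : k) : Khat k)) ?_ ?_
    · intro m n h
      have := congrArg (fun f : Khat k => f.coeff m) h
      by_contra hmn
      simp [hmn] at this
    · intro n
      rw [Oball_eq_ordBall]
      intro i hi
      exact HahnSeries.coeff_single_of_ne (by lia)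
  have := hinf.meas_eq_top (μ := μ) ⟨μ {x}, hne, fun y _ => by rw [hx x, hx y]⟩
  rw [hO] at this
  exact ENNReal.one_ne_top this

lemma measure_Kset : μ (Kset k) = 0 := by
  have : NullSingletonClass μ := ⟨measure_singleton_Khat hinv hO⟩
  exact countable_Kset.measure_zero μ

lemma inter_cK_ae_eq (s : Set (Khat k)) : (s ∩ cK k : Set (Khat k)) =ᵐ[μ] s := by
  refine inter_ae_eq_left_of_ae_eq_univ ?_
  rw [ae_eq_univ, cK, compl_compl]
  exact measure_Kset hinv hO

lemma setLIntegral_Jset :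
    ∫⁻ x in Jset k, ENNReal.ofReal ((absInf x ^ 2)⁻¹) ∂μ = (Fintype.card k : ℝ≥0∞)⁻¹ := by
  set q : ℝ := (Fintype.card k : ℝ) with hq
  have hq1 : 1 < q := one_lt_card_real
  have hq0 : 0 < q := zero_lt_one.trans hq1
  let S : ℕ → Set (Khat k) := fun d => ordBall k (-(d + 1 : ℕ)) \ ordBall k (-d)
  have hJ : Jset k = ⋃ d, S d := by
    rw [Jset_eq_compl_ordBall]
    ext f
    simp only [S, Set.mem_compl_iff, Set.mem_iUnion, Set.mem_sdiff]
    constructor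
    · intro hf
      have hf0 : f ≠ 0 := by rintro rfl; exact hf fun _ _ => rfl
      have ho : f.order < 0 := by
        by_contra! h
        exact hf (ordBall_anti h (mem_ordBall_order f))
      refine ⟨(-f.order - 1).toNat, ordBall_anti (by lia) (mem_ordBall_order f), fun h => ?_⟩
      exact not_mem_ordBall_order_add_one hf0 (ordBall_anti (by lia) h)
    · rintro ⟨d, -, h⟩ h'
      exact h (ordBall_anti (by lia) h')
  have hmeas (d : ℕ) : MeasurableSet (S d) :=
    (measurableSet_ordBall _).diff (measurableSet_ordBall _)
  have hdisj : Pairwise (Function.onFun Disjoint S) := by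
    have key {m n : ℕ} (h : m < n) : Disjoint (S m) (S n) :=
      Set.disjoint_left.mpr fun f hf hf' => hf'.2 (ordBall_anti (by lia) hf.1)
    intro m n hmn
    rcases hmn.lt_or_gt with h | h
    · exact key h
    · exact (key h).symm
  have hμS (d : ℕ) : μ (S d) = ENNReal.ofReal (q ^ (d + 1) - q ^ d) := by
    have hB (d : ℕ) : μ (ordBall k (-d)) = ENNReal.ofReal (q ^ d) := by
      rw [measure_ordBall_neg hinv hO, ENNReal.ofReal_pow hq0.le, hq, ENNReal.ofReal_natCast]
    rw [measure_sdiff (ordBall_anti (by lia)) (measurableSet_ordBall _).nullMeasurableSet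
      (by rw [hB]; exact ENNReal.ofReal_ne_top), hB, hB, ENNReal.ofReal_sub _ (by positivity)]
  have hterm (d : ℕ) : ∫⁻ x in S d, ENNReal.ofReal ((absInf x ^ 2)⁻¹) ∂μ
      = ENNReal.ofReal ((q - 1) / q ^ 2 * q⁻¹ ^ d) := by
    have hc : ∀ x ∈ S d, ENNReal.ofReal ((absInf x ^ 2)⁻¹)
        = ENNReal.ofReal (((q ^ (d + 1)) ^ 2)⁻¹) := by
      intro x hx
      rw [absInf_eq_of_mem_ordBall hx.1 (by
        have : -((d + 1 : ℕ) : ℤ) + 1 = -d := by lia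
        rw [this]
        exact hx.2), neg_neg, zpow_natCast]
    rw [setLIntegral_congr_fun (hmeas d) hc, setLIntegral_const, hμS,
      ← ENNReal.ofReal_mul (by positivity)]
    congr 1
    rw [inv_pow]
    field_simp
    ring
  have hsum : HasSum (fun d : ℕ => (q - 1) / q ^ 2 * q⁻¹ ^ d) q⁻¹ := by
    have h := (hasSum_geometric_of_lt_one (inv_nonneg.mpr hq0.le)
      (inv_lt_one_of_one_lt₀ hq1)).mul_left ((q - 1) / q ^ 2)
    have h0 : q - 1 ≠ 0 := (sub_pos.mpr hq1).ne'
    have h1 : 1 - q⁻¹ = (q - 1) / q := by field_simp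
    have h2 : (q - 1) / q ^ 2 * (1 - q⁻¹)⁻¹ = q⁻¹ := by
      rw [h1]
      field_simp
    rwa [h2] at h
  rw [hJ, lintegral_iUnion hmeas hdisj]
  simp_rw [hterm]
  rw [← ENNReal.ofReal_tsum_of_nonneg (fun d => mul_nonneg
    (div_nonneg (sub_nonneg.mpr hq1.le) (by positivity)) (by positivity)) hsum.summable,
    hsum.tsum_eq, ENNReal.ofReal_inv_of_pos hq0, hq, ENNReal.ofReal_natCast]

end Invariant

lemma card_sq_mul_inv_mul_inv :
    (Fintype.card k : ℝ≥0∞) ^ 2 *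
      ((Fintype.card k : ℝ≥0∞)⁻¹ * (Fintype.card k : ℝ≥0∞)⁻¹) = 1 := by
  rw [← sq, ← mul_pow, ENNReal.mul_inv_cancel (by simp) (ENNReal.natCast_ne_top _), one_pow]

end Helpers

/-- The measure `m̂` on `Ω` with density `q²/|ξ₊ - ξ₋|²` with respect to
`μ ⊗ μ` is a probability measure; explicitly,
`q² ∫_J ∫_(X⁻¹O) |ξ₊ - ξ₋|⁻² dμ(ξ₊) dμ(ξ₋) = 1`. -/
theorem statement_8 (k : Type*) [Field k] [Fintype k] (μ : MeasureTheory.Measure (Khat k))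
    (hinv : ∀ x : Khat k, MeasureTheory.Measure.map (fun y => x + y) μ = μ)
    (hO : μ (Oball k) = 1) :
    MeasureTheory.IsProbabilityMeasure (mhat k μ) ∧
    (Fintype.card k : ℝ≥0∞) ^ 2 *
        ∫⁻ ξm in Jset k,
          (∫⁻ ξp in XinvO k, ENNReal.ofReal (((absInf (ξp - ξm)) ^ 2)⁻¹) ∂μ) ∂μ
      = 1 := by
  have hmeas : Measurable fun x : Khat k => ENNReal.ofReal ((absInf x ^ 2)⁻¹) :=
    ((measurable_absInf.pow_const 2).inv).ennreal_ofReal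
  constructor
  · have := sigmaFinite_of_invariant hinv hO
    have hcK : MeasurableSet (cK k) := countable_Kset.measurableSet.compl
    have hΩ : MeasurableSet (OmegaSet k) :=
      (measurableSet_Jset.inter hcK).prod (measurableSet_XinvO.inter hcK)
    have hdens : ∀ p ∈ OmegaSet k, dens k p
        = (Fintype.card k : ℝ≥0∞) ^ 2 * ENNReal.ofReal ((absInf p.1 ^ 2)⁻¹) * 1 := by
      intro p hp
      rw [dens, absInf_sub_of_mem hp.1.1 hp.2.1, ENNReal.ofReal_mul (by positivity),
        ENNReal.ofReal_pow (by positivity), ENNReal.ofReal_natCast, mul_one]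
    constructor
    rw [mhat, Measure.restrict_apply_univ, withDensity_apply _ hΩ,
      setLIntegral_congr_fun hΩ hdens, OmegaSet, ← Measure.prod_restrict,
      lintegral_prod_mul (hmeas.const_mul _).aemeasurable aemeasurable_const,
      setLIntegral_one, measure_congr (inter_cK_ae_eq hinv hO _),
      setLIntegral_congr (inter_cK_ae_eq hinv hO _), lintegral_const_mul _ hmeas,
      setLIntegral_Jset hinv hO, measure_XinvO hinv hO, mul_assoc, card_sq_mul_inv_mul_inv]
  · have hinner : ∀ x ∈ Jset k,
        ∫⁻ y in XinvO k, ENNReal.ofReal ((absInf (y - x) ^ 2)⁻¹) ∂μ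
          = ENNReal.ofReal ((absInf x ^ 2)⁻¹) * (Fintype.card k : ℝ≥0∞)⁻¹ := by
      intro x hx
      rw [← measure_XinvO hinv hO, ← setLIntegral_const]
      exact setLIntegral_congr_fun measurableSet_XinvO fun y hy => by
        simp only [absInf_sub_of_mem hx hy]
    rw [setLIntegral_congr_fun measurableSet_Jset hinner, lintegral_mul_const _ hmeas,
      setLIntegral_Jset hinv hO, card_sq_mul_inv_mul_inv]

end ArtinCoding
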